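/- The nested session type U characterizes the language L₃ = {Lⁿ a Rⁿ a | n > 0} ∪ {Lⁿ b Rⁿ b | n > 0}: consider the signature with definitions U = ⊕{L : O[C[A], C[B]]}, O[x,y] = ⊕{L : O[C[x], C[y]], a : x, b : y}, C[x] = ⊕{R : x}, A = ⊕{a : 1}, B = ⊕{b : 1}, its internal renaming Σ', and the grammar fog(Σ') with rule set S. For every word w over the alphabet {L, R, a, b}, the corresponding action sequence (mapping each symbol s to ⊕s) rewrites ⟦U⟧ to the non-terminal ⊥ (i.e., ⟦U⟧ --w--> ⊥ in S) if and only if w ∈ L₃. -/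

import Mathlib

/-- Labels for internal/external choice. -/
abbrev Label := Nat
/-- Type variables. -/
abbrev TVar := Nat
/-- Defined type names. -/
abbrev TName := Nat

/-- Session types: internal choice, external choice, tensor, lolli, 1,
type variables, and applications `V[B₁,…,Bₙ]` of defined type names
(represented by an arity `n` together with a function giving the arguments). -/
inductive STy : Type where
  | ichoice : List Label → (Label → STy) → STy
  | echoice : List Label → (Label → STy) → STy
  | tensor  : STy → STy → STy
  | lolli   : STy → STy → STy
  | one     : STy
  | var     : TVar → STy
  | app     : TName → (n : Nat) → (Nat → STy) → STy

namespace STy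

/-- Capture-free substitution of types for type variables. -/
def subst (σ : TVar → STy) : STy → STy
  | ichoice L f => ichoice L (fun l => (f l).subst σ)
  | echoice L f => echoice L (fun l => (f l).subst σ)
  | tensor A B  => tensor (A.subst σ) (B.subst σ)
  | lolli A B   => lolli (A.subst σ) (B.subst σ)
  | one         => one
  | var a       => σ a
  | app V n f   => app V n (fun i => (f i).subst σ)

/-- Free type variables. -/
def fv : STy → Set TVar
  | ichoice L f => {a | ∃ l ∈ L, a ∈ (f l).fv}
  | echoice L f => {a | ∃ l ∈ L, a ∈ (f l).fv}
  | tensor A B  => A.fv ∪ B.fv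
  | lolli A B   => A.fv ∪ B.fv
  | one         => ∅
  | var a       => {a}
  | app _ n f   => {a | ∃ i < n, a ∈ (f i).fv}

/-- A type is closed if it has no free type variables. -/
def closed (A : STy) : Prop := A.fv = ∅

/-- Defined type names occurring in a type. -/
def names : STy → Set TName
  | ichoice L f => {V | ∃ l ∈ L, V ∈ (f l).names}
  | echoice L f => {V | ∃ l ∈ L, V ∈ (f l).names}
  | tensor A B  => A.names ∪ B.names
  | lolli A B   => A.names ∪ B.names
  | one         => ∅
  | var _       => ∅
  | app V n f   => insert V {W | ∃ i < n, W ∈ (f i).names}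

/-- Labels occurring in a type. -/
def labels : STy → Set Label
  | ichoice L f => {l | l ∈ L} ∪ {l | ∃ l' ∈ L, l ∈ (f l').labels}
  | echoice L f => {l | l ∈ L} ∪ {l | ∃ l' ∈ L, l ∈ (f l').labels}
  | tensor A B  => A.labels ∪ B.labels
  | lolli A B   => A.labels ∪ B.labels
  | one         => ∅
  | var _       => ∅
  | app _ n f   => {l | ∃ i < n, l ∈ (f i).labels}

/-- A type is a type-name application. -/
def isApp : STy → Prop
  | app _ _ _ => True
  | _ => False

end STy

/-- A signature: a partial map from type names to (arity, body) definitions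
`V[α₀,…,α_{n-1}] = A` (at most one definition per name). -/
abbrev Sig := TName → Option (Nat × STy)

/-- Domain of a signature. -/
def Sig.dom (Sg : Sig) : Set TName := {V | Sg V ≠ none}

/-- A signature is contractive: no definition body is itself a type name
application. -/
def Contractive (Sg : Sig) : Prop :=
  ∀ V n A, Sg V = some (n, A) → ¬ A.isApp

/-- Unfolding: `unfold (V[B̄]) = A[B̄/ᾱ]` when `V[ᾱ] = A ∈ Σ`, and
`unfold A = A` otherwise. -/
def unfoldT (Sg : Sig) : STy → STy
  | .app V n f =>
      match Sg V with
      | some (_, A) => A.subst f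
      | none        => .app V n f
  | A => A

/-- A relation on (closed) session types is a type bisimulation. -/
def IsBisim (Sg : Sig) (R : STy → STy → Prop) : Prop :=
  ∀ A B, R A B →
    (∀ L f, unfoldT Sg A = .ichoice L f →
      ∃ g, unfoldT Sg B = .ichoice L g ∧ ∀ l ∈ L, R (f l) (g l)) ∧
    (∀ L f, unfoldT Sg A = .echoice L f →
      ∃ g, unfoldT Sg B = .echoice L g ∧ ∀ l ∈ L, R (f l) (g l)) ∧
    (∀ A1 A2, unfoldT Sg A = .tensor A1 A2 →
      ∃ B1 B2, unfoldT Sg B = .tensor B1 B2 ∧ R A1 B1 ∧ R A2 B2) ∧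
    (∀ A1 A2, unfoldT Sg A = .lolli A1 A2 →
      ∃ B1 B2, unfoldT Sg B = .lolli B1 B2 ∧ R A1 B1 ∧ R A2 B2) ∧
    (unfoldT Sg A = .one → unfoldT Sg B = .one)

/-- Type equality `A ≡_Σ B` of closed types: some type bisimulation (on
closed types) relates `A` and `B`. -/
def TypeEq (Sg : Sig) (A B : STy) : Prop :=
  ∃ R : STy → STy → Prop,
    IsBisim Sg R ∧ (∀ X Y, R X Y → X.closed ∧ Y.closed) ∧ R A B

/-- Open type equality `∀𝒱. A ≡_Σ B`: equality of all closed instances. -/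
def EqForall (Sg : Sig) (Vs : Set TVar) (A B : STy) : Prop :=
  ∀ σ : TVar → STy, (∀ a ∈ Vs, (σ a).closed) →
    TypeEq Sg (A.subst σ) (B.subst σ)
/-- First-order grammar terms over ranked non-terminals (type names),
a nullary non-terminal `⊥`, and variables. -/
inductive GTerm : Type where
  | bot : GTerm
  | var : Nat → GTerm
  | app : TName → (n : Nat) → (Nat → GTerm) → GTerm

/-- Substitution of terms for variables in a grammar term. -/
def GTerm.subst (σ : Nat → GTerm) : GTerm → GTerm
  | .bot => .bot
  | .var i => σ i
  | .app X n f => .app X n (fun i => (f i).subst σ)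

/-- Grammar actions: `⊕ℓ`, `&ℓ`, `⊗₁/⊗₂`, `⊸₁/⊸₂`. -/
inductive Act : Type where
  | ich : Label → Act
  | ech : Label → Act
  | tens : Bool → Act
  | lol : Bool → Act
deriving DecidableEq

/-- A production rule `X ᾱ --a--> E`: non-terminal, arity, action, body. -/
abbrev GRule := TName × Nat × Act × GTerm

/-- A set of production rules. -/
abbrev GRules := Set GRule

/-- One rewriting step of closed terms: `T --a--> T'`. -/
def GStep (S : GRules) (T : GTerm) (a : Act) (T' : GTerm) : Prop :=
  ∃ X n f E, T = .app X n f ∧ (X, n, a, E) ∈ S ∧ T' = E.subst f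

/-- Multi-step rewriting along a word of actions: `T --w--> T'`. -/
inductive GSteps (S : GRules) : GTerm → List Act → GTerm → Prop where
  | refl (T) : GSteps S T [] T
  | step {T a T' w T''} : GStep S T a T' → GSteps S T' w T'' →
      GSteps S T (a :: w) T''

/-- The trace of a term: all words along which it can rewrite. -/
def traceS (S : GRules) (T : GTerm) : Set (List Act) :=
  {w | ∃ T', GSteps S T w T'}

/-- Trace equivalence `T ∼_S T'`. -/
def TraceEquiv (S : GRules) (T T' : GTerm) : Prop :=
  traceS S T = traceS S T'

/-- The translation `⟦·⟧` from (atomic) session types to grammar terms: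
`⟦1⟧ = ⊥`, `⟦α⟧ = α`, `⟦V[B̄]⟧ = V ⟦B̄⟧` (structural types are not in its
intended domain). -/
def embed : STy → GTerm
  | .one => .bot
  | .var a => .var a
  | .app V n f => .app V n (fun i => embed (f i))
  | _ => .bot

/-- A type is atomic (in the domain of `⟦·⟧`): `1`, a variable, or a type
name application. -/
def Atomic : STy → Prop
  | .one => True
  | .var _ => True
  | .app _ _ _ => True
  | _ => False

/-- A signature is internally renamed: in every definition, the immediate
subexpressions of the body are `1`, a variable, or a type name application. -/
def Renamed (Sg : Sig) : Prop :=
  ∀ V n A, Sg V = some (n, A) →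
    (∀ L f, A = .ichoice L f → ∀ l ∈ L, Atomic (f l)) ∧
    (∀ L f, A = .echoice L f → ∀ l ∈ L, Atomic (f l)) ∧
    (∀ A1 A2, A = .tensor A1 A2 → Atomic A1 ∧ Atomic A2) ∧
    (∀ A1 A2, A = .lolli A1 A2 → Atomic A1 ∧ Atomic A2)

/-- The rule translation `τ`: each definition contributes one rule per
possible action, with the corresponding translated continuation. -/
def tau (Sg : Sig) : GRules :=
  {r | ∃ V n A, Sg V = some (n, A) ∧
    ((∃ L f, A = .ichoice L f ∧
        ∃ l ∈ L, r = (V, n, Act.ich l, embed (f l))) ∨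
     (∃ L f, A = .echoice L f ∧
        ∃ l ∈ L, r = (V, n, Act.ech l, embed (f l))) ∨
     (∃ A1 A2, A = .tensor A1 A2 ∧
        (r = (V, n, Act.tens false, embed A1) ∨
         r = (V, n, Act.tens true, embed A2))) ∨
     (∃ A1 A2, A = .lolli A1 A2 ∧
        (r = (V, n, Act.lol false, embed A1) ∨
         r = (V, n, Act.lol true, embed A2))))}
/-! The `L₃` signature: type names `U := 0`, `O := 1`, `C := 2`, `A := 3`,
`B := 4`; labels `L := 0`, `R := 1`, `a := 2`, `b := 3`.  Definitions:
`U = ⊕{L : O[C[A], C[B]]}`, `O[x,y] = ⊕{L : O[C[x], C[y]], a : x, b : y}`,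
`C[x] = ⊕{R : x}`, `A = ⊕{a : 1}`, `B = ⊕{b : 1}`.
All immediate subexpressions of the bodies are already atomic, so this
signature is its own internal renaming. -/
def SgL3 : Sig := fun V =>
  if V = 0 then
    some (0, .ichoice [0] (fun _ =>
      .app 1 2 (fun i =>
        if i = 0 then .app 2 1 (fun _ => .app 3 0 (fun _ => .one))
        else .app 2 1 (fun _ => .app 4 0 (fun _ => .one)))))
  else if V = 1 then
    some (2, .ichoice [0, 2, 3] (fun l =>
      if l = 0 then .app 1 2 (fun i => .app 2 1 (fun _ => .var i))
      else if l = 2 then .var 0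
      else .var 1))
  else if V = 2 then some (1, .ichoice [1] (fun _ => .var 0))
  else if V = 3 then some (0, .ichoice [2] (fun _ => .one))
  else if V = 4 then some (0, .ichoice [3] (fun _ => .one))
  else none

/-- The alphabet `{L, R, a, b}`. -/
inductive L3Sym : Type where
  | L | R | a | b
deriving DecidableEq

/-- The action corresponding to a symbol `s`: `⊕s`. -/
def l3Act : L3Sym → Act
  | .L => Act.ich 0
  | .R => Act.ich 1
  | .a => Act.ich 2
  | .b => Act.ich 3

/-- The language `L₃ = {Lⁿ a Rⁿ a | n > 0} ∪ {Lⁿ b Rⁿ b | n > 0}`. -/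
def InL3 (w : List L3Sym) : Prop :=
  ∃ n : Nat, 0 < n ∧
    (w = List.replicate n L3Sym.L ++ [L3Sym.a] ++
         List.replicate n L3Sym.R ++ [L3Sym.a] ∨
     w = List.replicate n L3Sym.L ++ [L3Sym.b] ++
         List.replicate n L3Sym.R ++ [L3Sym.b])

/-- The words over `{L, R, a, b}` along which a term rewrites to `⊥`. -/
def L3Accepts (T : GTerm) (w : List L3Sym) : Prop :=
  GSteps (tau SgL3) T (w.map l3Act) GTerm.bot

theorem l3Accepts_app_iff (X : TName) (n : ℕ) (f : ℕ → GTerm) (w : List L3Sym) :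
    L3Accepts (.app X n f) w ↔
      ∃ s w' E, w = s :: w' ∧ (X, n, l3Act s, E) ∈ tau SgL3 ∧ L3Accepts (E.subst f) w' := by
  constructor
  · intro h
    cases w with
    | nil => cases h
    | cons s w' =>
      cases h with
      | step h₁ h₂ =>
        obtain ⟨X', n', f', E, hT, hr, rfl⟩ := h₁
        cases hT
        exact ⟨s, w', E, rfl, hr, h₂⟩
  · rintro ⟨s, w', E, rfl, hr, h⟩
    exact .step ⟨X, n, f, E, rfl, hr, rfl⟩ h

theorem l3Accepts_bot_iff (w : List L3Sym) : L3Accepts .bot w ↔ w = [] := by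
  constructor
  · intro h
    cases w with
    | nil => rfl
    | cons s w' =>
      cases h with
      | step h₁ _ =>
        obtain ⟨_, _, _, _, hT, _⟩ := h₁
        cases hT
  · rintro rfl
    exact .refl _

theorem mem_tau_ichoice_iff {Sg : Sig} {X : TName} {m : ℕ} {L : List Label}
    {f : Label → STy} (hX : Sg X = some (m, .ichoice L f)) (n : ℕ) (l : Label) (E : GTerm) :
    (X, n, Act.ich l, E) ∈ tau Sg ↔ n = m ∧ l ∈ L ∧ E = embed (f l) := by
  constructor
  · rintro ⟨V, k, A, hV, h⟩
    rcases h with ⟨L', f', rfl, l', hl, he⟩ | ⟨L', f', rfl, l', hl, he⟩ |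
      ⟨_, _, rfl, he | he⟩ | ⟨_, _, rfl, he | he⟩
    · simp only [Prod.mk.injEq, Act.ich.injEq] at he
      obtain ⟨rfl, rfl, rfl, rfl⟩ := he
      rw [hX] at hV
      cases hV
      exact ⟨rfl, hl, rfl⟩
    all_goals simp at he
  · rintro ⟨rfl, hl, rfl⟩
    exact ⟨X, n, _, hX, .inl ⟨L, f, rfl, l, hl, rfl⟩⟩

theorem l3Accepts_app_ichoice_iff {X : TName} {n : ℕ} {L : List Label} {g : Label → STy}
    (hX : SgL3 X = some (n, .ichoice L g)) (f : ℕ → GTerm) (w : List L3Sym) :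
    L3Accepts (.app X n f) w ↔
      ∃ s w' l, w = s :: w' ∧ l3Act s = .ich l ∧ l ∈ L ∧
        L3Accepts ((embed (g l)).subst f) w' := by
  rw [l3Accepts_app_iff]
  constructor
  · rintro ⟨s, w', E, rfl, hr, h⟩
    obtain ⟨l, hl⟩ : ∃ l, l3Act s = .ich l := by cases s <;> exact ⟨_, rfl⟩
    rw [hl, mem_tau_ichoice_iff hX] at hr
    obtain ⟨-, hm, rfl⟩ := hr
    exact ⟨s, w', l, rfl, hl, hm, h⟩
  · rintro ⟨s, w', l, rfl, hl, hm, h⟩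
    exact ⟨s, w', _, rfl, hl ▸ (mem_tau_ichoice_iff hX n l _).2 ⟨rfl, hm, rfl⟩, h⟩

theorem l3Accepts_A_iff (f : ℕ → GTerm) (w : List L3Sym) :
    L3Accepts (.app 3 0 f) w ↔ w = [.a] := by
  rw [l3Accepts_app_ichoice_iff (X := 3) rfl]
  simp only [embed, GTerm.subst, l3Accepts_bot_iff]
  constructor
  · rintro ⟨s, w', l, rfl, hs, hl, rfl⟩
    cases s <;> simp_all [l3Act]
  · rintro rfl
    exact ⟨.a, [], 2, rfl, rfl, by simp, rfl⟩

theorem l3Accepts_B_iff (f : ℕ → GTerm) (w : List L3Sym) :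
    L3Accepts (.app 4 0 f) w ↔ w = [.b] := by
  rw [l3Accepts_app_ichoice_iff (X := 4) rfl]
  simp only [embed, GTerm.subst, l3Accepts_bot_iff]
  constructor
  · rintro ⟨s, w', l, rfl, hs, hl, rfl⟩
    cases s <;> simp_all [l3Act]
  · rintro rfl
    exact ⟨.b, [], 3, rfl, rfl, by simp, rfl⟩

theorem l3Accepts_C_iff (f : ℕ → GTerm) (w : List L3Sym) :
    L3Accepts (.app 2 1 f) w ↔ ∃ w', w = .R :: w' ∧ L3Accepts (f 0) w' := by
  rw [l3Accepts_app_ichoice_iff (X := 2) rfl]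
  simp only [embed, GTerm.subst]
  constructor
  · rintro ⟨s, w', l, rfl, hs, hl, h⟩
    cases s <;> simp_all [l3Act]
  · rintro ⟨w', rfl, h⟩
    exact ⟨.R, w', 1, rfl, rfl, by simp, h⟩

theorem l3Accepts_O_iff (f : ℕ → GTerm) (w : List L3Sym) :
    L3Accepts (.app 1 2 f) w ↔ ∃ w',
      (w = .L :: w' ∧ L3Accepts (.app 1 2 fun i => .app 2 1 fun _ => f i) w') ∨
      (w = .a :: w' ∧ L3Accepts (f 0) w') ∨ (w = .b :: w' ∧ L3Accepts (f 1) w') := by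
  rw [l3Accepts_app_ichoice_iff (X := 1) rfl]
  constructor
  · rintro ⟨s, w', l, rfl, hs, hl, h⟩
    refine ⟨w', ?_⟩
    cases s <;> cases hs <;> simp at hl
    · exact .inl ⟨rfl, h⟩
    · exact .inr (.inl ⟨rfl, h⟩)
    · exact .inr (.inr ⟨rfl, h⟩)
  · rintro ⟨w', ⟨rfl, h⟩ | ⟨rfl, h⟩ | ⟨rfl, h⟩⟩
    · exact ⟨.L, w', 0, rfl, rfl, by simp, h⟩
    · exact ⟨.a, w', 2, rfl, rfl, by simp, h⟩
    · exact ⟨.b, w', 3, rfl, rfl, by simp, h⟩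

theorem l3Accepts_U_iff (f : ℕ → GTerm) (w : List L3Sym) :
    L3Accepts (.app 0 0 f) w ↔ ∃ w', w = .L :: w' ∧
      L3Accepts (.app 1 2 fun i =>
        .app 2 1 fun _ => if i = 0 then .app 3 0 fun _ => .bot else .app 4 0 fun _ => .bot) w' := by
  have key : ((embed (.app 1 2 (fun i =>
        if i = 0 then .app 2 1 (fun _ => .app 3 0 (fun _ => .one))
        else .app 2 1 (fun _ => .app 4 0 (fun _ => .one))))).subst f) =
      .app 1 2 fun i => .app 2 1 fun _ =>
        if i = 0 then .app 3 0 fun _ => .bot else .app 4 0 fun _ => .bot := by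
    simp only [embed, GTerm.subst]
    congr 1
    funext i
    split_ifs <;> rfl
  rw [l3Accepts_app_ichoice_iff (X := 0) rfl, key]
  constructor
  · rintro ⟨s, w', l, rfl, hs, hl, h⟩
    cases s <;> simp_all [l3Act]
  · rintro ⟨w', rfl, h⟩
    exact ⟨.L, w', 0, rfl, rfl, by simp, h⟩

/-- If `x` and `y` accept exactly `Rⁿ a` and `Rⁿ b`, then `O[x, y]` accepts exactly the words
`Lᵏ s Rⁿ⁺ᵏ s` with `s ∈ {a, b}`. -/
theorem l3Accepts_O_iff_exists (w : List L3Sym) (n : ℕ) (f : ℕ → GTerm)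
    (ha : ∀ v, L3Accepts (f 0) v ↔ v = List.replicate n .R ++ [.a])
    (hb : ∀ v, L3Accepts (f 1) v ↔ v = List.replicate n .R ++ [.b]) :
    L3Accepts (.app 1 2 f) w ↔ ∃ k,
      w = List.replicate k .L ++ [.a] ++ List.replicate (n + k) .R ++ [.a] ∨
      w = List.replicate k .L ++ [.b] ++ List.replicate (n + k) .R ++ [.b] := by
  induction w generalizing n f with
  | nil =>
    rw [l3Accepts_O_iff]
    simp
  | cons s w ih =>
    have ih' := ih (n + 1) (fun i => .app 2 1 fun _ => f i)
      (by simp [l3Accepts_C_iff, ha, List.replicate_succ])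
      (by simp [l3Accepts_C_iff, hb, List.replicate_succ])
    rw [l3Accepts_O_iff]
    simp only [ha, hb, List.cons.injEq]
    constructor
    · rintro ⟨w', ⟨⟨rfl, rfl⟩, h⟩ | ⟨⟨rfl, rfl⟩, rfl⟩ | ⟨⟨rfl, rfl⟩, rfl⟩⟩
      · obtain ⟨k, hk⟩ := ih'.1 h
        refine ⟨k + 1, ?_⟩
        rcases hk with rfl | rfl <;> simp [List.replicate_succ, add_assoc, add_comm 1 k]
      · exact ⟨0, by simp⟩
      · exact ⟨0, by simp⟩
    · rintro ⟨_ | k, hk⟩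
      · refine ⟨w, .inr ?_⟩
        simpa using hk
      · have e : n + (k + 1) = n + 1 + k := by omega
        refine ⟨w, .inl ?_⟩
        rw [e] at hk
        rw [ih']
        rcases hk with hk | hk <;>
          simp only [List.replicate_succ, List.cons_append, List.cons.injEq] at hk
        · exact ⟨⟨hk.1, rfl⟩, k, .inl hk.2⟩
        · exact ⟨⟨hk.1, rfl⟩, k, .inr hk.2⟩

/-- **Theorem (Statement 14).** The nested session type `U` characterizes the
language `L₃`: for every word `w` over `{L, R, a, b}`, the corresponding
action sequence rewrites `⟦U⟧` to the non-terminal `⊥` in the grammar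
`fog(Σ')` (where `Σ'` is the internal renaming of the `L₃` signature, here
the signature itself) iff `w ∈ L₃`. -/
theorem l3_characterization :
    ∀ w : List L3Sym,
      GSteps (tau SgL3) (embed (.app 0 0 (fun _ => .one))) (w.map l3Act) GTerm.bot
        ↔ InL3 w := by
  intro w
  change L3Accepts (.app 0 0 fun _ => .bot) w ↔ InL3 w
  rw [l3Accepts_U_iff]
  have h := fun v => l3Accepts_O_iff_exists v 1
    (fun i => .app 2 1 fun _ => if i = 0 then .app 3 0 fun _ => .bot else .app 4 0 fun _ => .bot)
    (by simp [l3Accepts_C_iff, l3Accepts_A_iff]) (by simp [l3Accepts_C_iff, l3Accepts_B_iff])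
  simp only [h]
  constructor
  · rintro ⟨v, rfl, k, rfl | rfl⟩
    · exact ⟨k + 1, k.succ_pos, .inl (by simp [List.replicate_succ, add_comm 1 k])⟩
    · exact ⟨k + 1, k.succ_pos, .inr (by simp [List.replicate_succ, add_comm 1 k])⟩
  · rintro ⟨_ | k, hn, hw⟩
    · exact absurd hn (lt_irrefl 0)
    · rw [add_comm k 1] at hw
      rcases hw with rfl | rfl
      · exact ⟨_, by simp [List.replicate_succ, add_comm 1 k], k, .inl rfl⟩
      · exact ⟨_, by simp [List.replicate_succ, add_comm 1 k], k, .inr rfl⟩
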